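/- arXiv:2310.06986 — 4 statements merged into one kernel-verified Lean document; each statement's English description precedes it below -/
import Mathlib

section
/- Let i ≥ 2 and j ≥ 1 be integers, and let · denote the Euclidean dot product in ℝ². Then ∫_△ ṽ^I_{ij}(x,y) · B_{ij}(x,y) dx dy = 8/( (2i−1) (2j+2i−1) (j+2i−1) ). -/
open MeasureTheory

/-- Jacobi polynomial `P_n^{(a,b)}` via the Rodrigues formula (on `(-1,1)`). -/
noncomputable def jacobiP (n a b : ℕ) (x : ℝ) : ℝ :=
  (1 / ((2:ℝ)^n * (Nat.factorial n : ℝ) * (1 - x)^a * (1 + x)^b)) *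
    iteratedDeriv n (fun t : ℝ => (1 - t)^a * (1 + t)^b * (t^2 - 1)^n) x

/-- Legendre polynomial `L_n = P_n^{(0,0)}`. -/
noncomputable def legendreP (n : ℕ) (x : ℝ) : ℝ := jacobiP n 0 0 x

/-- Integrated Jacobi polynomial `P̂_n^a(x) = ∫_{-1}^x P_{n-1}^{(a,0)}(t) dt`. -/
noncomputable def intJacobiP (n a : ℕ) (x : ℝ) : ℝ :=
  ∫ t in (-1:ℝ)..x, jacobiP (n - 1) a 0 t

/-- Integrated Legendre polynomial `L̂_n`. -/
noncomputable def intLegendreP (n : ℕ) (x : ℝ) : ℝ := intJacobiP n 0 x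

/-- The open reference triangle with vertices `(-1,-1)`, `(1,-1)`, `(0,1)`. -/
def Tri : Set (ℝ × ℝ) := {p | -1 < p.2 ∧ p.2 < 1 ∧ |p.1| < (1 - p.2) / 2}

/-- Euclidean dot product in `ℝ²`. -/
def dot2 (p q : ℝ × ℝ) : ℝ := p.1 * q.1 + p.2 * q.2

/-- Auxiliary `H(curl)` interior field `ṽ^I_{ij} = (∇f_i) g_{ij}` on the triangle. -/
noncomputable def vtTriI (i j : ℕ) (p : ℝ × ℝ) : ℝ × ℝ :=
  (legendreP (i-1) (2*p.1 / (1 - p.2)) * ((1 - p.2)/2)^(i-1) * intJacobiP j (2*i) p.2,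
   (1/2) * legendreP (i-2) (2*p.1 / (1 - p.2)) * ((1 - p.2)/2)^(i-1) * intJacobiP j (2*i) p.2)

/-- Auxiliary `H(curl)` interior field `ṽ^II_{ij} = f_i ∇g_{ij}` on the triangle. -/
noncomputable def vtTriII (i j : ℕ) (p : ℝ × ℝ) : ℝ × ℝ :=
  (0, intLegendreP i (2*p.1 / (1 - p.2)) * ((1 - p.2)/2)^i * jacobiP (j-1) (2*i) 0 p.2)

/-- First dual candidate `B_{kl}` on the triangle. -/
noncomputable def Btri (k l : ℕ) (p : ℝ × ℝ) : ℝ × ℝ :=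
  (legendreP (k-1) (2*p.1 / (1 - p.2)) * ((1 - p.2)/2)^(k-1) * jacobiP (l-1) (2*k-1) 1 p.2, 0)

/-- Second dual candidate `C_{kl}` on the triangle. -/
noncomputable def Ctri (k l : ℕ) (p : ℝ × ℝ) : ℝ × ℝ :=
  (((k:ℝ) + 1) * jacobiP (k-1) 1 1 (2*p.1 / (1 - p.2)) * ((1 - p.2)/2)^(k-1) *
     jacobiP (l-1) (2*k) 0 p.2,
   -2*(k:ℝ) * jacobiP (k-2) 1 1 (2*p.1 / (1 - p.2)) * ((1 - p.2)/2)^(k-1) *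
     jacobiP (l-1) (2*k) 0 p.2)

section

open Polynomial

noncomputable def jI (p : ℝ[X]) : ℝ := ∫ x in (-1:ℝ)..1, p.eval x

theorem jI_ii (p : ℝ[X]) (a b : ℝ) : IntervalIntegrable (fun x => p.eval x) volume a b :=
  p.continuous.intervalIntegrable a b

theorem jI_deriv (p : ℝ[X]) (a b : ℝ) : ∫ x in a..b, (derivative p).eval x = p.eval b - p.eval a :=
  intervalIntegral.integral_eq_sub_of_hasDerivAt (fun x _ => p.hasDerivAt x) (jI_ii _ _ _)

theorem jI_add (p q : ℝ[X]) : jI (p + q) = jI p + jI q := by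
  simp only [jI, eval_add]
  exact intervalIntegral.integral_add (jI_ii _ _ _) (jI_ii _ _ _)

theorem jI_C_mul (c : ℝ) (p : ℝ[X]) : jI (C c * p) = c * jI p := by
  simp [jI, eval_mul]

theorem jI_parts (p q : ℝ[X]) (h1 : p.eval 1 = 0) (h2 : p.eval (-1) = 0) :
    jI (derivative p * q) = - jI (p * derivative q) := by
  have h : jI (derivative (p * q)) = 0 := by
    rw [jI, jI_deriv]; simp [h1, h2]
  rw [derivative_mul, jI_add] at h
  linarith

theorem jI_iter (k : ℕ) : ∀ (V Q : ℝ[X]), (X ^ 2 - 1 : ℝ[X]) ^ k ∣ V →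
    jI (derivative^[k] V * Q) = (-1) ^ k * jI (V * derivative^[k] Q) := by
  induction k with
  | zero => intro V Q _; simp
  | succ k ih =>
    intro V Q hV
    have h1 : (X ^ 2 - 1 : ℝ[X]) ^ k ∣ derivative V := by
      have := pow_sub_dvd_iterate_derivative_of_pow_dvd 1 hV
      simpa using this
    have hd : (X ^ 2 - 1 : ℝ[X]) ∣ V := (dvd_pow_self _ (Nat.succ_ne_zero k)).trans hV
    obtain ⟨U, hU⟩ := hd
    rw [Function.iterate_succ_apply, ih _ _ h1, jI_parts, Function.iterate_succ_apply']
    · ring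
    · simp [hU]
    · simp [hU]

theorem iter_top (n : ℕ) (Q : ℝ[X]) (hQ : Q.natDegree ≤ n) :
    derivative^[n] Q = C ((n.factorial : ℝ) * Q.coeff n) := by
  ext m
  rw [coeff_iterate_derivative, coeff_C]
  split_ifs with h
  · subst h; simp [Nat.descFactorial_self]
  · rw [coeff_eq_zero_of_natDegree_lt (by omega)]; simp

theorem jI_beta (q : ℕ) : ∀ p : ℕ, jI ((1 - X) ^ p * (1 + X) ^ q) =
    2 ^ (p + q + 1) * p.factorial * q.factorial / (p + q + 1).factorial := by
  induction q with
  | zero =>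
    intro p
    have h : ((1 - X) ^ p * (1 + X) ^ 0 : ℝ[X]) =
        derivative (C (-(1 / ((p:ℝ) + 1))) * (1 - X) ^ (p + 1)) := by
      rw [derivative_C_mul, derivative_pow_succ]
      have : (C (-(1 / ((p:ℝ) + 1))) : ℝ[X]) * C ((p:ℝ) + 1) = -1 := by
        rw [← C_mul, ← C_1, ← C_neg]; congr 1; field_simp
      simp only [map_add, map_natCast, map_one] at this ⊢
      simp only [derivative_sub, derivative_one, derivative_X, Nat.cast_add, Nat.cast_one]
      linear_combination (1 - X) ^ p * this
    rw [h, jI, jI_deriv]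
    simp [Nat.factorial_succ]
    have : (p.factorial : ℝ) ≠ 0 := by positivity
    field_simp
    norm_num
  | succ q ih =>
    intro p
    have h : jI (derivative ((1 - X : ℝ[X]) ^ (p + 1) * (1 + X) ^ (q + 1))) = 0 := by
      rw [jI, jI_deriv]; simp
    have h2 : derivative ((1 - X : ℝ[X]) ^ (p + 1) * (1 + X) ^ (q + 1)) =
      C (-((p:ℝ) + 1)) * ((1 - X) ^ p * (1 + X) ^ (q + 1)) +
      C ((q:ℝ) + 1) * ((1 - X) ^ (p + 1) * (1 + X) ^ q) := by
      rw [derivative_mul, derivative_pow_succ, derivative_pow_succ]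
      simp
      ring
    rw [h2, jI_add, jI_C_mul, jI_C_mul, ih] at h
    have : ((p:ℝ) + 1) * jI ((1 - X) ^ p * (1 + X) ^ (q + 1)) = ((q:ℝ) + 1) *
      (2 ^ (p + 1 + q + 1) * (p + 1).factorial * q.factorial / (p + 1 + q + 1).factorial) := by
      linarith
    rw [show p + (q + 1) + 1 = p + 1 + q + 1 by ring]
    have hp : (p:ℝ) + 1 ≠ 0 := by positivity
    apply mul_left_cancel₀ hp
    rw [this, Nat.factorial_succ p, Nat.factorial_succ q]
    push_cast
    ring

noncomputable def jW (n a b : ℕ) : ℝ[X] := (1 - X) ^ a * (1 + X) ^ b * (X ^ 2 - 1) ^ n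

theorem jW_eq (n a b : ℕ) : jW n a b = C ((-1) ^ n) * ((1 - X) ^ (a + n) * (1 + X) ^ (b + n)) := by
  rw [jW, show (X ^ 2 - 1 : ℝ[X]) = C (-1) * ((1 - X) * (1 + X)) by simp; ring]
  rw [mul_pow, mul_pow, C_pow]
  ring

theorem jW_natDegree (n a b : ℕ) : (jW n a b).natDegree = a + b + 2 * n ∧
    (jW n a b).leadingCoeff = (-1) ^ a := by
  have e : jW n a b = C ((-1) ^ a) * ((X - C 1) ^ (a + n) * (X - C (-1)) ^ (b + n)) := by
    rw [jW, show (X ^ 2 - 1 : ℝ[X]) = (X - C 1) * (X - C (-1)) by simp; ring,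
      show (1 - X : ℝ[X]) = C (-1) * (X - C 1) by simp]
    simp only [mul_pow, C_pow, pow_add]
    simp
    ring
  have hm : ((X - C (1:ℝ)) ^ (a + n) * (X - C (-1)) ^ (b + n)).Monic :=
    ((monic_X_sub_C _).pow _).mul ((monic_X_sub_C _).pow _)
  constructor
  · rw [e, natDegree_C_mul (by simp), ((monic_X_sub_C _).pow _).natDegree_mul ((monic_X_sub_C _).pow _)]
    rw [natDegree_pow, natDegree_pow, natDegree_X_sub_C, natDegree_X_sub_C]
    ring
  · rw [e, leadingCoeff_mul, hm.leadingCoeff]; simp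

theorem jJ_exists (n a b : ℕ) : ∃ J : ℝ[X], derivative^[n] (jW n a b) =
    C (2 ^ n * (n.factorial : ℝ)) * ((1 - X) ^ a * (1 + X) ^ b) * J ∧ J.natDegree ≤ n ∧
    J.coeff n = ((2 * n + a + b).descFactorial n : ℝ) / (2 ^ n * n.factorial) := by
  have h1 : (1 - X : ℝ[X]) ^ a ∣ derivative^[n] (jW n a b) := by
    have : (1 - X : ℝ[X]) ^ (a + n) ∣ jW n a b := by
      rw [jW_eq]; exact ⟨C ((-1) ^ n) * (1 + X) ^ (b + n), by ring⟩
    simpa using pow_sub_dvd_iterate_derivative_of_pow_dvd n this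
  have h2 : (1 + X : ℝ[X]) ^ b ∣ derivative^[n] (jW n a b) := by
    have : (1 + X : ℝ[X]) ^ (b + n) ∣ jW n a b := by
      rw [jW_eq]; exact ⟨C ((-1) ^ n) * (1 - X) ^ (a + n), by ring⟩
    simpa using pow_sub_dvd_iterate_derivative_of_pow_dvd n this
  have hc : IsCoprime ((1 - X : ℝ[X]) ^ a) ((1 + X : ℝ[X]) ^ b) := by
    apply IsCoprime.pow
    refine ⟨C (1/2), C (1/2), ?_⟩
    have : (C (1/2 : ℝ) : ℝ[X]) * 2 = 1 := by
      rw [show (2:ℝ[X]) = C 2 from rfl, ← C_mul]; norm_num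
    linear_combination this
  obtain ⟨K, hK⟩ := hc.mul_dvd h1 h2
  set c : ℝ := 2 ^ n * (n.factorial : ℝ) with hcdef
  have hc0 : c ≠ 0 := by positivity
  obtain ⟨hd, hl⟩ := jW_natDegree n a b
  have hmon : (C ((-1) ^ a) * ((1 - X) ^ a * (1 + X) ^ b) : ℝ[X]) = (X - C 1) ^ a * (X - C (-1)) ^ b := by
    rw [show (1 - X : ℝ[X]) = C (-1) * (X - C 1) by simp, mul_pow, ← C_pow]
    rw [show (X - C (-1) : ℝ[X]) = 1 + X by simp; ring]
    rw [← mul_assoc, ← mul_assoc, ← C_mul, ← mul_pow]; simp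
  set M : ℝ[X] := (X - C 1) ^ a * (X - C (-1)) ^ b with hM
  have hMm : M.Monic := ((monic_X_sub_C _).pow _).mul ((monic_X_sub_C _).pow _)
  have hMd : M.natDegree = a + b := by
    rw [hM, ((monic_X_sub_C _).pow _).natDegree_mul ((monic_X_sub_C _).pow _),
      natDegree_pow, natDegree_pow, natDegree_X_sub_C, natDegree_X_sub_C]; simp
  have hK2 : C ((-1) ^ a) * derivative^[n] (jW n a b) = M * K := by
    rw [hK, ← hmon]; ring
  have hdeg : (M * K).natDegree ≤ a + b + n := by
    rw [← hK2]
    refine (natDegree_C_mul_le _ _).trans ((natDegree_iterate_derivative _ _).trans ?_)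
    omega
  have hKd : K.natDegree ≤ n := by
    by_cases hK0 : K = 0
    · simp [hK0]
    rw [hMm.natDegree_mul' hK0, hMd] at hdeg
    omega
  have hKc : K.coeff n = (2 * n + a + b).descFactorial n := by
    have e1 : (M * K).coeff (a + b + n) = K.coeff n := by
      rw [coeff_mul_add_eq_of_natDegree_le hMd.le hKd, ← hMd, hMm.coeff_natDegree, one_mul]
    rw [← e1, ← hK2, coeff_C_mul, coeff_iterate_derivative]
    have : (jW n a b).coeff (a + b + n + n) = (-1) ^ a := by
      rw [← hl, leadingCoeff, hd]; congr 1; ring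
    rw [this, show a + b + n + n = 2 * n + a + b by ring, nsmul_eq_mul, mul_left_comm, ← mul_pow]
    simp
  refine ⟨C c⁻¹ * K, ?_, ?_, ?_⟩
  · rw [hK]
    have : (C c * C c⁻¹ : ℝ[X]) = 1 := by rw [← C_mul, mul_inv_cancel₀ hc0, C_1]
    linear_combination -((1 - X) ^ a * (1 + X) ^ b * K) * this
  · exact (natDegree_C_mul_le _ _).trans hKd
  · rw [coeff_C_mul, hKc]; field_simp

noncomputable def jJ (n a b : ℕ) : ℝ[X] := (jJ_exists n a b).choose

theorem jJ_rod (n a b : ℕ) : derivative^[n] (jW n a b) =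
    C (2 ^ n * (n.factorial : ℝ)) * ((1 - X) ^ a * (1 + X) ^ b) * jJ n a b :=
  (jJ_exists n a b).choose_spec.1

theorem jJ_deg (n a b : ℕ) : (jJ n a b).natDegree ≤ n := (jJ_exists n a b).choose_spec.2.1

theorem jJ_coeff (n a b : ℕ) : (jJ n a b).coeff n =
    ((2 * n + a + b).descFactorial n : ℝ) / (2 ^ n * n.factorial) :=
  (jJ_exists n a b).choose_spec.2.2

theorem iterDeriv_poly (n : ℕ) : ∀ (p : ℝ[X]),
    iteratedDeriv n (fun x => p.eval x) = fun x => (derivative^[n] p).eval x := by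
  induction n with
  | zero => intro p; simp
  | succ n ih =>
    intro p
    rw [iteratedDeriv_succ', Function.iterate_succ_apply, ← ih]
    congr 1
    ext x
    exact p.deriv

theorem jacobi_eval (n a b : ℕ) (x : ℝ) (h1 : -1 < x) (h2 : x < 1) :
    jacobiP n a b x = (jJ n a b).eval x := by
  have e : (fun t : ℝ => (1 - t)^a * (1 + t)^b * (t^2 - 1)^n) = fun t => (jW n a b).eval t := by
    ext t; simp [jW]
  rw [jacobiP, e, iterDeriv_poly, jJ_rod]
  have : 1 - x ≠ 0 := by linarith
  have : 1 + x ≠ 0 := by linarith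
  simp only [eval_mul, eval_C, eval_pow, eval_sub, eval_add, eval_one, eval_X]
  field_simp

/-- weighted integral of a Jacobi polynomial against a polynomial of degree at most n -/
theorem jJ_int (n a b : ℕ) (Q : ℝ[X]) (hQ : Q.natDegree ≤ n) :
    jI ((1 - X) ^ a * (1 + X) ^ b * jJ n a b * Q) =
      Q.coeff n * 2 ^ (a + b + n + 1) * (a + n).factorial * (b + n).factorial /
        (a + b + 2 * n + 1).factorial := by
  have h := jI_iter n (jW n a b) Q ⟨(1 - X) ^ a * (1 + X) ^ b, by rw [jW]; ring⟩
  rw [iter_top n Q hQ, jJ_rod, jW_eq] at h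
  rw [show C (2 ^ n * (n.factorial : ℝ)) * ((1 - X) ^ a * (1 + X) ^ b) * jJ n a b * Q =
    C (2 ^ n * (n.factorial : ℝ)) * ((1 - X) ^ a * (1 + X) ^ b * jJ n a b * Q) by ring, jI_C_mul,
    mul_comm (_ * _) (C _), jI_C_mul, jI_C_mul, jI_beta] at h
  have hs : ((-1:ℝ) ^ n) * (-1) ^ n = 1 := by rw [← mul_pow]; simp
  have hc0 : (2:ℝ) ^ n * (n.factorial : ℝ) ≠ 0 := by positivity
  apply mul_left_cancel₀ hc0
  rw [h]
  rw [show a + n + (b + n) + 1 = a + b + 2 * n + 1 by ring]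
  rw [show a + b + 2 * n + 1 = (a + b + n + 1) + n by ring, pow_add 2 _ n]
  linear_combination (↑n.factorial * Q.coeff n * (2 ^ (a + b + n + 1) * 2 ^ n * ↑(a + n).factorial * ↑(b + n).factorial / ↑(a + b + n + 1 + n).factorial)) * hs

theorem legendre_norm (m : ℕ) : jI (jJ m 0 0 * jJ m 0 0) = 2 / (2 * m + 1) := by
  have h := jJ_int m 0 0 _ (jJ_deg m 0 0)
  simp only [pow_zero, one_mul, zero_add, jJ_coeff] at h
  rw [h]
  have h2 := Nat.factorial_mul_descFactorial (show m ≤ 2 * m by omega)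
  rw [show 2 * m - m = m by omega] at h2
  have h2 : (m.factorial : ℝ) * (2 * m).descFactorial m = (2 * m).factorial := by exact_mod_cast h2
  rw [Nat.factorial_succ]
  simp only [add_zero]
  push_cast
  rw [← h2]
  have : (m.factorial : ℝ) ≠ 0 := by positivity
  have : ((2 * m).descFactorial m : ℝ) ≠ 0 := by
    have : (2 * m).descFactorial m ≠ 0 := by rw [Ne, Nat.descFactorial_eq_zero_iff_lt]; omega
    exact_mod_cast this
  rw [pow_succ]
  field_simp

theorem prim_exists (n : ℕ) (J : ℝ[X]) (hJ : J.natDegree ≤ n) : ∃ q : ℝ[X],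
    derivative ((1 + X) * q) = J ∧ q.natDegree ≤ n ∧ q.coeff n = J.coeff n / (n + 1) := by
  set G : ℝ[X] := ∑ k ∈ Finset.range (n + 1), C (J.coeff k / (k + 1)) * X ^ (k + 1) with hG
  have hGd : G.natDegree ≤ n + 1 := by
    apply natDegree_sum_le_of_forall_le
    intro k hk
    refine (natDegree_C_mul_X_pow_le _ _).trans ?_
    simp at hk; omega
  have hGc : G.coeff (n + 1) = J.coeff n / (n + 1) := by
    rw [hG, finsetSum_coeff, Finset.sum_eq_single n]
    · simp
    · intro k _ hk
      rw [coeff_C_mul_X_pow, if_neg (by omega)]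
    · simp
  have hD : derivative G = J := by
    rw [hG, derivative_sum]
    conv_rhs => rw [J.as_sum_range' (n + 1) (by omega)]
    apply Finset.sum_congr rfl
    intro k _
    rw [derivative_C_mul_X_pow, ← C_mul_X_pow_eq_monomial]
    simp only [Nat.add_sub_cancel]
    congr 2
    push_cast
    field_simp
  have hr : (X - C (-1)) ∣ G - C (G.eval (-1)) := by
    rw [dvd_iff_isRoot]; simp
  obtain ⟨q, hq⟩ := hr
  have hm := monic_X_sub_C (-1 : ℝ)
  have hle : (G - C (G.eval (-1))).natDegree ≤ n + 1 := by
    rw [natDegree_sub_C]; exact hGd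
  have hqd : q.natDegree ≤ n := by
    by_cases h0 : q = 0
    · simp [h0]
    rw [hq, hm.natDegree_mul' h0, natDegree_X_sub_C] at hle
    omega
  refine ⟨q, ?_, hqd, ?_⟩
  · rw [show (1 + X) = (X - C (-1) : ℝ[X]) by simp; ring, ← hq]; simp [hD]
  · rw [← hGc]
    have : (G - C (G.eval (-1))).coeff (n + 1) = G.coeff (n + 1) := by simp [coeff_C]
    rw [← this, hq, add_comm n 1, coeff_mul_add_eq_of_natDegree_le (natDegree_X_sub_C_le _) hqd]
    simp [coeff_one]

theorem inner_int (m : ℕ) (s : ℝ) (hs : 0 < s) :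
    ∫ x in (-s)..s, ((jJ m 0 0).eval (x / s) * s ^ m) ^ 2 = s ^ (2 * m + 1) * (2 / (2 * m + 1)) := by
  have h := intervalIntegral.integral_comp_div (a := -s) (b := s)
    (fun u => ((jJ m 0 0).eval u * s ^ m) ^ 2) hs.ne'
  rw [h, neg_div, div_self hs.ne', ← legendre_norm, jI, smul_eq_mul]
  have : (fun u => ((jJ m 0 0).eval u * s ^ m) ^ 2) =
    fun u => s ^ (2 * m) * ((jJ m 0 0 * jJ m 0 0).eval u) := by
    ext u; rw [eval_mul]; ring
  rw [this, intervalIntegral.integral_const_mul]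
  ring

theorem intJ_eval (n a : ℕ) (q : ℝ[X]) (hq : derivative ((1 + X) * q) = jJ n a 0) (y : ℝ)
    (h1 : -1 < y) (h2 : y < 1) : intJacobiP (n + 1) a y = (1 + y) * q.eval y := by
  rw [intJacobiP]
  have : ∫ t in (-1:ℝ)..y, jacobiP (n + 1 - 1) a 0 t = ∫ t in (-1:ℝ)..y, (jJ n a 0).eval t := by
    apply intervalIntegral.integral_congr_ae
    refine Filter.Eventually.of_forall fun t ht => ?_
    rw [Set.uIoc_of_le h1.le] at ht
    exact jacobi_eval _ _ _ _ ht.1 (by linarith [ht.2])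
  rw [this, ← hq, jI_deriv]
  simp

theorem homog_exists (m : ℕ) (P : ℝ[X]) (hP : P.natDegree ≤ m) : ∃ F : ℝ × ℝ → ℝ, Continuous F ∧
    ∀ x s : ℝ, s ≠ 0 → F (x, s) = P.eval (x / s) * s ^ m := by
  refine ⟨fun p => ∑ k ∈ Finset.range (m + 1), P.coeff k * p.1 ^ k * p.2 ^ (m - k), by fun_prop, ?_⟩
  intro x s hs
  rw [eval_eq_sum_range' (Nat.lt_succ_of_le hP), Finset.sum_mul]
  apply Finset.sum_congr rfl
  intro k hk
  have hk : k ≤ m := by simp at hk; omega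
  obtain ⟨d, rfl⟩ := Nat.exists_eq_add_of_le hk
  rw [Nat.add_sub_cancel_left, pow_add, div_pow]
  field_simp

theorem tri_int (f : ℝ × ℝ → ℝ) (hf : Continuous f) :
    ∫ p in Tri, f p = ∫ y in (-1:ℝ)..1, ∫ x in (-((1 - y) / 2))..((1 - y) / 2), f (x, y) := by
  have hm : MeasurableSet Tri := by
    apply IsOpen.measurableSet
    have : Tri = {p : ℝ × ℝ | -1 < p.2} ∩ {p | p.2 < 1} ∩ {p | |p.1| < (1 - p.2) / 2} := by
      ext p; simp [Tri, and_assoc]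
    rw [this]
    refine ((isOpen_lt ?_ ?_).inter (isOpen_lt ?_ ?_)).inter (isOpen_lt ?_ ?_) <;> fun_prop
  have hi : IntegrableOn f Tri := by
    have hc : IsCompact (Set.Icc (-1:ℝ) 1 ×ˢ Set.Icc (-1:ℝ) 1) := isCompact_Icc.prod isCompact_Icc
    refine (hf.continuousOn.integrableOn_compact hc).mono_set ?_
    rintro ⟨x, y⟩ ⟨h1, h2, h3⟩
    simp only at h1 h2 h3
    rw [abs_lt] at h3
    refine ⟨⟨?_, ?_⟩, ⟨?_, ?_⟩⟩ <;> simp only <;> linarith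
  rw [← integral_indicator hm, Measure.volume_eq_prod, integral_prod_symm]
  · rw [intervalIntegral.integral_of_le (by norm_num), integral_Ioc_eq_integral_Ioo,
      ← integral_indicator measurableSet_Ioo]
    congr 1
    ext y
    by_cases hy : y ∈ Set.Ioo (-1:ℝ) 1
    · rw [Set.indicator_of_mem hy, intervalIntegral.integral_of_le (by linarith [hy.2]),
        integral_Ioc_eq_integral_Ioo, ← integral_indicator measurableSet_Ioo]
      congr 1
      ext x
      have : (x, y) ∈ Tri ↔ x ∈ Set.Ioo (-((1 - y) / 2)) ((1 - y) / 2) := by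
        simp only [Tri, Set.mem_setOf_eq, abs_lt, Set.mem_Ioo]
        exact ⟨fun h => h.2.2, fun h => ⟨hy.1, hy.2, h⟩⟩
      by_cases h : (x, y) ∈ Tri
      · rw [Set.indicator_of_mem h, Set.indicator_of_mem (this.1 h)]
      · rw [Set.indicator_of_notMem h, Set.indicator_of_notMem (fun h' => h (this.2 h'))]
    · rw [Set.indicator_of_notMem hy]
      have : ∀ x, Tri.indicator f (x, y) = 0 := fun x =>
        Set.indicator_of_notMem (fun h => hy ⟨h.1, h.2.1⟩) _
      simp [this]
  · rw [← Measure.volume_eq_prod]; exact hi.integrable_indicator hm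

theorem main_aux (m n : ℕ) :
    ∫ p in Tri, dot2 (vtTriI (m + 1) (n + 1) p) (Btri (m + 1) (n + 1) p) =
      8 / ((2 * (m:ℝ) + 1) * (2 * n + 2 * m + 3) * (n + 2 * m + 2)) := by
  obtain ⟨F, hFc, hF⟩ := homog_exists m _ (jJ_deg m 0 0)
  obtain ⟨q, hq, hqd, hqc⟩ := prim_exists n _ (jJ_deg n (2 * (m + 1)) 0)
  set R : ℝ[X] := (1 + X) * q * jJ n (2 * m + 1) 1 with hR
  have hm : MeasurableSet Tri := by
    apply IsOpen.measurableSet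
    have : Tri = {p : ℝ × ℝ | -1 < p.2} ∩ {p | p.2 < 1} ∩ {p | |p.1| < (1 - p.2) / 2} := by
      ext p; simp [Tri, and_assoc]
    rw [this]
    refine ((isOpen_lt ?_ ?_).inter (isOpen_lt ?_ ?_)).inter (isOpen_lt ?_ ?_) <;> fun_prop
  have h1 : ∫ p in Tri, dot2 (vtTriI (m + 1) (n + 1) p) (Btri (m + 1) (n + 1) p) =
      ∫ p in Tri, (F (p.1, (1 - p.2) / 2)) ^ 2 * R.eval p.2 := by
    apply setIntegral_congr_fun hm
    rintro ⟨x, y⟩ ⟨hy1, hy2, hx⟩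
    simp only at hy1 hy2 hx
    have hs : 0 < (1 - y) / 2 := by linarith
    have he : 2 * x / (1 - y) = x / ((1 - y) / 2) := by field_simp
    have hx' : |x / ((1 - y) / 2)| < 1 := by
      rw [abs_div, abs_of_pos hs, div_lt_one hs]; exact hx
    rw [abs_lt] at hx'
    simp only [dot2, vtTriI, Btri, legendreP, he, mul_zero, add_zero, Nat.add_sub_cancel]
    rw [jacobi_eval _ _ _ _ hx'.1 hx'.2, jacobi_eval _ _ _ _ hy1 hy2,
      intJ_eval n _ q hq y hy1 hy2, hF _ _ hs.ne', hR,
      show 2 * (m + 1) - 1 = 2 * m + 1 by omega]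
    simp only [eval_mul, eval_add, eval_one, eval_X]
    ring
  rw [h1, tri_int _ (by fun_prop)]
  have h2 : ∫ y in (-1:ℝ)..1, ∫ x in (-((1 - y) / 2))..((1 - y) / 2),
      (F (x, (1 - y) / 2)) ^ 2 * R.eval y =
      ∫ y in (-1:ℝ)..1, (2 / (2 * (m:ℝ) + 1) * (1 / 2) ^ (2 * m + 1)) * ((1 - X) ^ (2 * m + 1) * (1 + X) ^ 1 *
        jJ n (2 * m + 1) 1 * q : ℝ[X]).eval y := by
    rw [intervalIntegral.integral_of_le (by norm_num), intervalIntegral.integral_of_le (by norm_num),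
      integral_Ioc_eq_integral_Ioo, integral_Ioc_eq_integral_Ioo]
    apply setIntegral_congr_fun measurableSet_Ioo
    intro y hy
    have hs : 0 < (1 - y) / 2 := by linarith [hy.2]
    simp only
    rw [intervalIntegral.integral_mul_const]
    simp only [hF _ _ hs.ne']
    rw [inner_int m _ hs, hR]
    simp only [eval_mul, eval_add, eval_one, eval_X, eval_sub, eval_pow]
    rw [show (1 - y) / 2 = (1 / 2) * (1 - y) by ring, mul_pow]
    ring
  rw [h2, intervalIntegral.integral_const_mul]
  have h3 := jJ_int n (2 * m + 1) 1 q hqd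
  rw [jI] at h3
  rw [h3, hqc, jJ_coeff]
  have h4 := Nat.factorial_mul_descFactorial (show n ≤ 2 * n + 2 * (m + 1) + 0 by omega)
  rw [show 2 * n + 2 * (m + 1) + 0 - n = (2 * m + 1 + n) + 1 by omega] at h4
  rw [show 2 * m + 1 + 1 + 2 * n + 1 = (2 * n + 2 * (m + 1) + 0) + 1 by ring,
    Nat.factorial_succ (_ + 0), ← h4, Nat.factorial_succ (2 * m + 1 + n), add_comm 1 n,
    Nat.factorial_succ n]
  have hd : ((2 * n + 2 * (m + 1) + 0).descFactorial n : ℝ) ≠ 0 := by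
    have : (2 * n + 2 * (m + 1) + 0).descFactorial n ≠ 0 := by
      rw [Ne, Nat.descFactorial_eq_zero_iff_lt]; omega
    exact_mod_cast this
  set D := (2 * n + 2 * (m + 1) + 0).descFactorial n
  have hn : (n.factorial : ℝ) ≠ 0 := by positivity
  have hmn : ((2 * m + 1 + n).factorial : ℝ) ≠ 0 := by positivity
  rw [show 2 * m + 1 + 1 + n + 1 = (2 * m + 1) + n + 2 by ring, pow_add (2:ℝ) _ 2, pow_add (2:ℝ) (2 * m + 1) n,
    one_div_pow]
  push_cast
  have e1 : (2:ℝ) * n + 2 * m + 3 ≠ 0 := by positivity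
  have e2 : (n:ℝ) + 2 * m + 2 ≠ 0 := by positivity
  have e3 : (2:ℝ) * n + 2 * (m + 1) + 0 + 1 ≠ 0 := by positivity
  have e4 : (2:ℝ) * m + 1 + n + 1 ≠ 0 := by positivity
  field_simp
  ring

end

/-- The diagonal value `∫_△ ṽ^I_{ij} · B_{ij}`. -/
theorem triangle_Hcurl_diagonal_I (i j : ℕ) (hi : 2 ≤ i) (hj : 1 ≤ j) :
    ∫ p in Tri, dot2 (vtTriI i j p) (Btri i j p) =
      8 / ((2*(i:ℝ) - 1) * (2*(j:ℝ) + 2*(i:ℝ) - 1) * ((j:ℝ) + 2*(i:ℝ) - 1)) := by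
  obtain ⟨m, rfl⟩ : ∃ m, i = m + 1 := ⟨i - 1, by omega⟩
  obtain ⟨n, rfl⟩ : ∃ n, j = n + 1 := ⟨j - 1, by omega⟩
  rw [main_aux]
  push_cast
  congr 1
  ring
end

section
/- Let i ≥ 2 and j ≥ 1 be integers, and let · denote the Euclidean dot product in ℝ². Then ∫_△ ṽ^II_{ij}(x,y) · C_{ij}(x,y) dx dy = 16/( (2i−1) (2j+2i−1) ). -/
open MeasureTheory

open Polynomial in
lemma aux_iterDeriv (p : ℝ[X]) (n : ℕ) :
    iteratedDeriv n (fun t => p.eval t) = fun t => (derivative^[n] p).eval t := by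
  induction n with
  | zero => simp [iteratedDeriv_zero]
  | succ n ih =>
    rw [iteratedDeriv_succ, ih, Function.iterate_succ_apply']
    funext t
    simp

open Polynomial in
lemma aux_ii (p : ℝ[X]) (a b : ℝ) : IntervalIntegrable (fun t => p.eval t) volume a b :=
  p.continuous.intervalIntegrable a b

open Polynomial in
lemma aux_ibp (n : ℕ) (f W : ℝ[X])
    (h1 : ∀ k < n, (derivative^[k] W).eval 1 = 0)
    (h2 : ∀ k < n, (derivative^[k] W).eval (-1) = 0) :
    ∫ x in (-1:ℝ)..1, f.eval x * (derivative^[n] W).eval x =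
      (-1)^n * ∫ x in (-1:ℝ)..1, (derivative^[n] f).eval x * W.eval x := by
  induction n generalizing f with
  | zero => simp
  | succ n ih =>
    have := intervalIntegral.integral_mul_deriv_eq_deriv_mul (a := (-1:ℝ)) (b := 1)
      (u := fun x => f.eval x) (v := fun x => (derivative^[n] W).eval x)
      (u' := fun x => (derivative f).eval x)
      (v' := fun x => (derivative (derivative^[n] W)).eval x)
      (fun x _ => f.hasDerivAt x) (fun x _ => (derivative^[n] W).hasDerivAt x)
      (aux_ii _ _ _) (aux_ii _ _ _)
    rw [Function.iterate_succ_apply', this, h1 n (by omega), h2 n (by omega),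
      ih (derivative f) (fun k hk => h1 k (by omega)) (fun k hk => h2 k (by omega)),
      ← Function.iterate_succ_apply]
    ring

lemma aux_beta (p q : ℕ) :
    ∫ x in (-1:ℝ)..1, (1 - x)^p * (1 + x)^q =
      2^(p+q+1) * (p.factorial : ℝ) * (q.factorial : ℝ) / ((p+q+1).factorial : ℝ) := by
  induction p generalizing q with
  | zero =>
    have h : ∫ x in (-1:ℝ)..1, (1 + x)^q = 2^(q+1) / ((q:ℝ)+1) := by
      have := intervalIntegral.integral_comp_add_left (a := (-1:ℝ)) (b := 1) (fun x : ℝ => x^q) 1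
      rw [this, integral_pow]
      norm_num
    simp only [pow_zero, one_mul, h, zero_add, Nat.factorial_succ, Nat.factorial_zero]
    have : (q.factorial : ℝ) ≠ 0 := by positivity
    push_cast
    field_simp
  | succ p ih =>
    have := intervalIntegral.integral_mul_deriv_eq_deriv_mul (a := (-1:ℝ)) (b := 1)
      (u := fun x => (1 - x)^(p+1)) (v := fun x => (1 + x)^(q+1) / ((q:ℝ)+1))
      (u' := fun x => -((p:ℝ)+1) * (1-x)^p)
      (v' := fun x => (1 + x)^q)
      (fun x _ => by
        have := ((hasDerivAt_id x).const_sub 1).pow (p+1)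
        convert! this using 1
        simp
        ring)
      (fun x _ => by
        have := (((hasDerivAt_id x).const_add 1).pow (q+1)).div_const ((q:ℝ)+1)
        convert! this using 1
        have : (q:ℝ)+1 ≠ 0 := by positivity
        simp
        field_simp)
      (Continuous.intervalIntegrable (by fun_prop) _ _)
      (Continuous.intervalIntegrable (by fun_prop) _ _)
    rw [this]
    have e : ∀ x : ℝ, -((p:ℝ)+1) * (1-x)^p * ((1 + x)^(q+1) / ((q:ℝ)+1)) =
      (-((p:ℝ)+1)/((q:ℝ)+1)) * ((1-x)^p * (1 + x)^(q+1)) := fun x => by ring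
    simp only [e]
    rw [intervalIntegral.integral_const_mul, ih (q+1)]
    have e1 : p + (q+1) + 1 = p + 1 + q + 1 := by ring
    rw [e1, Nat.factorial_succ p, Nat.factorial_succ q]
    have : (q:ℝ)+1 ≠ 0 := by positivity
    push_cast
    field_simp
    simp

open Polynomial in
noncomputable def auxw (a b : ℕ) : ℝ[X] := (1 - X)^a * (1 + X)^b

open Polynomial in
noncomputable def auxW (n a b : ℕ) : ℝ[X] := auxw a b * (X^2 - 1)^n

open Polynomial in
lemma auxW_eq (n a b : ℕ) : auxW n a b = C ((-1)^n) * auxw (a+n) (b+n) := by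
  have : (X^2 - 1 : ℝ[X]) = C (-1) * ((1 - X) * (1 + X)) := by
    simp; ring
  rw [auxW, auxw, auxw, this, C_pow, mul_pow (C (-1)), mul_pow (1 - X : ℝ[X]), pow_add, pow_add]
  ring

open Polynomial in
lemma auxw_eq (a b : ℕ) : auxw a b = C ((-1)^a) * ((X - C 1)^a * (X + C 1)^b) := by
  have : (1 - X : ℝ[X]) = C (-1) * (X - C 1) := by
    simp
  rw [auxw, this, C_pow, C_1, mul_pow, add_comm (1 : ℝ[X]) X]
  ring

open Polynomial in
lemma auxw_natDegree (a b : ℕ) : (auxw a b).natDegree = a + b := by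
  rw [auxw_eq, natDegree_C_mul (by simp),
    ((monic_X_sub_C (1:ℝ)).pow a).natDegree_mul ((monic_X_add_C (1:ℝ)).pow b),
    (monic_X_sub_C (1:ℝ)).natDegree_pow, (monic_X_add_C (1:ℝ)).natDegree_pow,
    natDegree_X_sub_C, natDegree_X_add_C]
  ring

open Polynomial in
lemma auxw_coeff (a b : ℕ) : (auxw a b).coeff (a + b) = (-1)^a := by
  have h := auxw_natDegree a b
  have : (auxw a b).leadingCoeff = (-1)^a := by
    rw [auxw_eq, leadingCoeff_mul, leadingCoeff_C,
      (((monic_X_sub_C (1:ℝ)).pow a).mul ((monic_X_add_C (1:ℝ)).pow b)).leadingCoeff, mul_one]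
  rw [leadingCoeff, h] at this
  exact this

open Polynomial in
lemma auxw_ne (a b : ℕ) : auxw a b ≠ 0 := by
  intro h
  have := auxw_coeff a b
  rw [h] at this
  simp at this
  have h2 : ((-1:ℝ))^a ≠ 0 := by simp
  exact h2 this.symm

open Polynomial in
lemma auxW_dvd (n a b : ℕ) : auxw a b ∣ derivative^[n] (auxW n a b) := by
  rw [auxW_eq, iterate_derivative_C_mul]
  apply Dvd.dvd.mul_left
  rw [auxw]
  apply IsCoprime.mul_dvd
  · apply IsCoprime.pow
    refine ⟨C (1/2), C (1/2), ?_⟩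
    have : (C (1/2) * 2 : ℝ[X]) = 1 := by
      rw [show (2:ℝ[X]) = C 2 from rfl, ← C_mul]; norm_num
    linear_combination this
  · have := pow_sub_dvd_iterate_derivative_of_pow_dvd (q := (1 - X : ℝ[X])) (p := auxw (a+n) (b+n))
      (n := a + n) n (Dvd.intro _ rfl)
    simpa using this
  · have := pow_sub_dvd_iterate_derivative_of_pow_dvd (q := (1 + X : ℝ[X])) (p := auxw (a+n) (b+n))
      (n := b + n) n (Dvd.intro_left _ rfl)
    simpa using this

open Polynomial in
lemma auxW_van (n a b k : ℕ) (hk : k < n) : (derivative^[k] (auxW n a b)).eval 1 = 0 ∧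
    (derivative^[k] (auxW n a b)).eval (-1) = 0 := by
  have h : ∀ p : ℝ[X], p ∣ (X^2-1) → p ∣ derivative^[k] (auxW n a b) := by
    intro p hp
    have := pow_sub_dvd_iterate_derivative_of_pow_dvd (q := p) (p := auxW n a b)
      (n := n) k (Dvd.dvd.mul_left (pow_dvd_pow_of_dvd hp n) _)
    exact (dvd_pow_self p (by omega)).trans this
  constructor
  · obtain ⟨c, hc⟩ := h (X - 1) ⟨X + 1, by ring⟩
    rw [hc]; simp
  · obtain ⟨c, hc⟩ := h (X + 1) ⟨X - 1, by ring⟩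
    rw [hc]; simp

open Polynomial in
noncomputable def auxQ (n a b : ℕ) : ℝ[X] := (auxW_dvd n a b).choose

open Polynomial in
lemma auxQ_spec (n a b : ℕ) : derivative^[n] (auxW n a b) = auxw a b * auxQ n a b :=
  (auxW_dvd n a b).choose_spec

open Polynomial in
lemma auxW_natDegree (n a b : ℕ) : (auxW n a b).natDegree = (a + n) + (b + n) := by
  rw [auxW_eq, natDegree_C_mul (by simp), auxw_natDegree]

open Polynomial in
lemma auxQ_natDegree (n a b : ℕ) : (auxQ n a b).natDegree ≤ n := by
  by_cases h : auxQ n a b = 0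
  · simp [h]
  have h1 := natDegree_iterate_derivative (auxW n a b) n
  rw [auxQ_spec, natDegree_mul (auxw_ne a b) h, auxW_natDegree, auxw_natDegree] at h1
  omega

open Polynomial in
lemma auxQ_coeff (n a b : ℕ) :
    (auxQ n a b).coeff n = ((2*n+a+b).factorial : ℝ) / ((n+a+b).factorial : ℝ) := by
  have h := coeff_mul_add_eq_of_natDegree_le (auxw_natDegree a b).le (auxQ_natDegree n a b)
  rw [← auxQ_spec, coeff_iterate_derivative, auxw_coeff, auxW_eq, coeff_C_mul,
    show a + b + n + n = (a+n) + (b+n) by ring, auxw_coeff] at h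
  have h3 := Nat.factorial_mul_descFactorial (n := (a+n)+(b+n)) (k := n) (by omega)
  rw [show a + n + (b+n) - n = n + a + b by omega, show a + n + (b+n) = 2*n+a+b by ring] at h3
  have h4 : ((n+a+b).factorial : ℝ) * ((2*n+a+b).descFactorial n : ℝ) = (2*n+a+b).factorial := by
    exact_mod_cast h3
  rw [eq_div_iff (by positivity), ← h4]
  rw [show a + n + (b+n) = 2*n+a+b by ring, nsmul_eq_mul, pow_add] at h
  have h5 : ((-1:ℝ)^n) * (-1)^n = 1 := by rw [← mul_pow]; simp
  have h6 : ((-1:ℝ)^a) * (-1)^a = 1 := by rw [← mul_pow]; simp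
  have h7 : (auxQ n a b).coeff n = ((2*n+a+b).descFactorial n : ℝ) := by
    calc (auxQ n a b).coeff n = (-1)^a * ((-1)^a * (auxQ n a b).coeff n) := by
          rw [← mul_assoc, h6, one_mul]
      _ = ((2*n+a+b).descFactorial n : ℝ) * (((-1:ℝ)^n) * (-1)^n) * (((-1:ℝ)^a) * (-1)^a) := by
          rw [← h]; ring
      _ = _ := by rw [h5, h6]; ring
  rw [h7]; ring

open Polynomial in
lemma auxQ_deriv (n a b : ℕ) :
    derivative^[n] (auxQ n a b) = C ((n.factorial : ℝ) * (auxQ n a b).coeff n) := by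
  have h1 := natDegree_iterate_derivative (auxQ n a b) n
  have h2 := auxQ_natDegree n a b
  rw [eq_C_of_natDegree_eq_zero (p := derivative^[n] (auxQ n a b)) (by omega),
    coeff_iterate_derivative]
  simp [Nat.descFactorial_self]

open Polynomial in
lemma auxQ_norm (n a b : ℕ) :
    ∫ x in (-1:ℝ)..1, (1-x)^a * (1+x)^b * ((auxQ n a b).eval x)^2 =
      (n.factorial : ℝ) * (((2*n+a+b).factorial : ℝ) / ((n+a+b).factorial : ℝ)) *
      (2^(2*n+a+b+1) * ((a+n).factorial : ℝ) * ((b+n).factorial : ℝ) /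
        ((2*n+a+b+1).factorial : ℝ)) := by
  have h := aux_ibp n (auxQ n a b) (auxW n a b) (fun k hk => (auxW_van n a b k hk).1)
    (fun k hk => (auxW_van n a b k hk).2)
  rw [auxQ_spec, auxQ_deriv, auxW_eq, auxQ_coeff] at h
  have hw : ∀ c d x, (auxw c d).eval x = (1-x)^c * (1+x)^d := by intro c d x; simp [auxw]
  simp only [eval_mul, eval_C, hw] at h
  rw [intervalIntegral.integral_const_mul, intervalIntegral.integral_const_mul, aux_beta,
    show a+n+(b+n)+1 = 2*n+a+b+1 by ring] at h
  have h5 : ((-1:ℝ)^n) * (-1)^n = 1 := by rw [← mul_pow]; simp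
  trans ∫ x in (-1:ℝ)..1, (auxQ n a b).eval x * ((1-x)^a * (1+x)^b * (auxQ n a b).eval x)
  · congr 1; funext x; ring
  rw [h]
  linear_combination ((n.factorial : ℝ) * (((2*n+a+b).factorial : ℝ) / ((n+a+b).factorial : ℝ)) *
      (2^(2*n+a+b+1) * ((a+n).factorial : ℝ) * ((b+n).factorial : ℝ) /
        ((2*n+a+b+1).factorial : ℝ))) * h5

open Polynomial in
lemma jacobiP_eq' (n a b : ℕ) (x : ℝ) : jacobiP n a b x =
    (1 / ((2:ℝ)^n * (Nat.factorial n : ℝ) * (1 - x)^a * (1 + x)^b)) *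
      (derivative^[n] (auxW n a b)).eval x := by
  have : (fun t : ℝ => (1 - t)^a * (1 + t)^b * (t^2 - 1)^n) = fun t => (auxW n a b).eval t := by
    funext t; simp [auxW, auxw]
  rw [jacobiP, this, aux_iterDeriv]

open Polynomial in
lemma jacobiP_eq (n a b : ℕ) (x : ℝ) (h1 : -1 < x) (h2 : x < 1) : jacobiP n a b x =
    (auxQ n a b).eval x / ((2:ℝ)^n * (Nat.factorial n : ℝ)) := by
  rw [jacobiP_eq', auxQ_spec]
  have h3 : 1 - x ≠ 0 := by linarith
  have h4 : 1 + x ≠ 0 := by linarith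
  simp [auxw]
  field_simp

open Polynomial in
lemma intLegendreP_eq (m : ℕ) (x : ℝ) (h1 : -1 < x) (h2 : x < 1) : intLegendreP (m+2) x =
    - ((1 - x^2) * jacobiP m 1 1 x / (2 * ((m:ℝ)+1))) := by
  rw [jacobiP_eq m 1 1 x h1 h2, intLegendreP, intJacobiP]
  have e : ∀ t, jacobiP (m+2-1) 0 0 t = (1 / ((2:ℝ)^(m+1) * ((m+1).factorial : ℝ))) *
      (derivative (derivative^[m] (auxW (m+1) 0 0))).eval t := by
    intro t
    rw [jacobiP_eq', ← Function.iterate_succ_apply' derivative]; simp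
  simp only [e]
  rw [intervalIntegral.integral_const_mul,
    intervalIntegral.integral_eq_sub_of_hasDerivAt
      (f := fun t => (derivative^[m] (auxW (m+1) 0 0)).eval t)
      (fun t _ => Polynomial.hasDerivAt _ t) (aux_ii _ _ _),
    (auxW_van (m+1) 0 0 m (by omega)).2]
  have e2 : auxW (m+1) 0 0 = C (-1) * auxW m 1 1 := by
    simp [auxW, auxw]; ring
  rw [e2, iterate_derivative_C_mul, auxQ_spec, Nat.factorial_succ]
  simp [auxw]
  field_simp
  ring

lemma aux_tri (F : ℝ × ℝ → ℝ) : ∫ p in Tri, F p =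
    ∫ p in (Set.Ioo (-1:ℝ) 1 ×ˢ Set.Ioo (-1:ℝ) 1),
      ((1 - p.2)/2) * F (p.1 * ((1 - p.2)/2), p.2) := by
  let f : ℝ × ℝ → ℝ × ℝ := fun p => (p.1 * ((1 - p.2)/2), p.2)
  let f' : ℝ × ℝ → (ℝ × ℝ →L[ℝ] ℝ × ℝ) := fun p =>
    (Matrix.toLin (.finTwoProd ℝ) (.finTwoProd ℝ)
      !![(1 - p.2)/2, -p.1/2; 0, 1]).toContinuousLinearMap
  have him : f '' (Set.Ioo (-1:ℝ) 1 ×ˢ Set.Ioo (-1:ℝ) 1) = Tri := by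
    ext ⟨x, y⟩
    simp only [Set.mem_image, Set.mem_prod, Set.mem_Ioo, Tri, Prod.exists, f, Prod.mk.injEq,
      Set.mem_ofPred_eq]
    constructor
    · rintro ⟨u, v, ⟨⟨hu1, hu2⟩, hv1, hv2⟩, rfl, rfl⟩
      refine ⟨hv1, hv2, ?_⟩
      have : 0 < (1 - v)/2 := by linarith
      rw [abs_lt]
      constructor <;> nlinarith
    · rintro ⟨h1, h2, h3⟩
      have h4 : 0 < (1 - y)/2 := by linarith
      rw [abs_lt] at h3
      refine ⟨x / ((1-y)/2), y, ⟨⟨?_, ?_⟩, h1, h2⟩, ?_, rfl⟩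
      · rw [lt_div_iff₀ h4]; linarith
      · rw [div_lt_iff₀ h4]; linarith
      · exact div_mul_cancel₀ x h4.ne'
  have hd : ∀ p, HasFDerivAt f (f' p) p := by
    intro p
    simp only [f', f]
    rw [Matrix.toLin_finTwoProd_toContinuousLinearMap]
    have h0 : HasFDerivAt (fun q : ℝ × ℝ => (1 - q.2)/2)
      ((-(1/2:ℝ)) • (ContinuousLinearMap.snd ℝ ℝ ℝ)) p := by
      have : HasFDerivAt (fun q : ℝ × ℝ => (1 - q.2)/2)
        ((2:ℝ)⁻¹ • (-(ContinuousLinearMap.snd ℝ ℝ ℝ))) p := by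
        simpa [div_eq_mul_inv] using
          ((hasFDerivAt_snd (𝕜 := ℝ) (E := ℝ) (F := ℝ) (p := p)).const_sub 1).mul_const (2:ℝ)⁻¹
      convert! this using 1
      ext <;> simp
    have h1 := (hasFDerivAt_fst (𝕜 := ℝ) (E := ℝ) (F := ℝ) (p := p)).mul h0
    have h2 := h1.prodMk (hasFDerivAt_snd (𝕜 := ℝ) (E := ℝ) (F := ℝ) (p := p))
    convert! h2 using 1
    ext <;> simp <;> ring
  have hdet : ∀ p, (f' p).det = (1 - p.2)/2 := by
    intro p
    simp only [f', LinearMap.det_toContinuousLinearMap, LinearMap.det_toLin,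
      Matrix.det_fin_two_of]
    ring
  have hm : MeasurableSet (Set.Ioo (-1:ℝ) 1 ×ˢ Set.Ioo (-1:ℝ) 1) :=
    measurableSet_Ioo.prod measurableSet_Ioo
  rw [← him, integral_image_eq_integral_abs_det_fderiv_smul volume hm
    (fun p _ => (hd p).hasFDerivWithinAt)]
  · apply setIntegral_congr_fun hm
    rintro ⟨u, v⟩ ⟨_, hv⟩
    simp only [Set.mem_Ioo] at hv
    simp only [hdet, f, smul_eq_mul]
    rw [abs_of_pos (by linarith)]
  · rintro ⟨u, v⟩ ⟨_, hv⟩ ⟨u', v'⟩ _ h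
    simp only [Set.mem_Ioo] at hv
    simp only [f, Prod.mk.injEq] at h
    obtain ⟨h, rfl⟩ := h
    have : (1 - v)/2 ≠ 0 := by linarith
    rw [mul_left_inj' this] at h
    rw [h]

/-- The diagonal value `∫_△ ṽ^II_{ij} · C_{ij}`. -/
theorem triangle_Hcurl_diagonal_II (i j : ℕ) (hi : 2 ≤ i) (hj : 1 ≤ j) :
    ∫ p in Tri, dot2 (vtTriII i j p) (Ctri i j p) =
      16 / ((2*(i:ℝ) - 1) * (2*(j:ℝ) + 2*(i:ℝ) - 1)) := by
  obtain ⟨m, rfl⟩ := Nat.exists_eq_add_of_le' hi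
  obtain ⟨n, rfl⟩ := Nat.exists_eq_add_of_le' hj
  have hm : MeasurableSet (Set.Ioo (-1:ℝ) 1 ×ˢ Set.Ioo (-1:ℝ) 1) :=
    measurableSet_Ioo.prod measurableSet_Ioo
  rw [aux_tri]
  have key : ∀ a b k : ℕ, ∀ g : ℝ → ℝ, ∀ c : ℝ, (∀ x, -1 < x → x < 1 → g x =
      c * ((1-x)^a * (1+x)^b * ((auxQ k a b).eval x)^2)) →
      ∫ x in Set.Ioo (-1:ℝ) 1, g x = c * ((k.factorial : ℝ) *
        (((2*k+a+b).factorial : ℝ) / ((k+a+b).factorial : ℝ)) *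
        (2^(2*k+a+b+1) * ((a+k).factorial : ℝ) * ((b+k).factorial : ℝ) /
        ((2*k+a+b+1).factorial : ℝ))) := by
    intro a b k g c hg
    rw [← auxQ_norm, ← intervalIntegral.integral_const_mul,
      intervalIntegral.integral_of_le (by norm_num), integral_Ioc_eq_integral_Ioo]
    exact setIntegral_congr_fun measurableSet_Ioo (fun x hx => hg x hx.1 hx.2)
  trans ∫ p in (Set.Ioo (-1:ℝ) 1 ×ˢ Set.Ioo (-1:ℝ) 1),
      (intLegendreP (m+2) p.1 * (-2 * ((m+2:ℕ):ℝ) * jacobiP m 1 1 p.1)) *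
      (((1-p.2)/2)^(2*(m+2)) * (jacobiP n (2*(m+2)) 0 p.2)^2)
  · apply setIntegral_congr_fun hm
    rintro ⟨u, v⟩ ⟨_, hv⟩
    simp only [Set.mem_Ioo] at hv
    have h0 : 1 - v ≠ 0 := by linarith
    have h1 : 2 * (u * ((1 - v)/2)) / (1 - v) = u := by field_simp
    simp only [dot2, vtTriII, Ctri, h1, Nat.add_sub_cancel, show m + 2 - 1 = m + 1 by omega]
    ring
  rw [Measure.volume_eq_prod, setIntegral_prod_mul
    (fun x => intLegendreP (m+2) x * (-2 * ((m+2:ℕ):ℝ) * jacobiP m 1 1 x))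
    (fun y => ((1-y)/2)^(2*(m+2)) * (jacobiP n (2*(m+2)) 0 y)^2)]
  rw [key 1 1 m _ (((m:ℝ)+2)/((m:ℝ)+1) / ((2:ℝ)^m * (m.factorial:ℝ))^2) ?_,
    key (2*(m+2)) 0 n _ (1 / 2^(2*(m+2)) / ((2:ℝ)^n * (n.factorial:ℝ))^2) ?_]
  · have e1 : (2*m+1+1+1).factorial = (2*m+3) * (2*m+1+1).factorial := Nat.factorial_succ _
    have e2 : (2*n+2*(m+2)+0+1).factorial = (2*n+2*(m+2)+1) * (2*n+2*(m+2)+0).factorial :=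
      Nat.factorial_succ _
    have e3 : (m+1+1).factorial = (m+2) * ((m+1) * m.factorial) := by
      rw [Nat.factorial_succ, Nat.factorial_succ]
    have e4 : (1+m).factorial = (m+1) * m.factorial := by
      rw [add_comm, Nat.factorial_succ]
    have e5 : (n+2*(m+2)+0).factorial = (2*(m+2)+n).factorial := by congr 1; ring
    rw [e1, e2, e3, e4, e5, zero_add]
    have hA : ((2*m+1+1).factorial : ℝ) ≠ 0 := by positivity
    have hB : ((2*n+2*(m+2)+0).factorial : ℝ) ≠ 0 := by positivity
    have hC : ((2*(m+2)+n).factorial : ℝ) ≠ 0 := by positivity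
    have hD : (m.factorial : ℝ) ≠ 0 := by positivity
    have hE : (n.factorial : ℝ) ≠ 0 := by positivity
    have hF : (2*((m:ℝ)+2) - 1) ≠ 0 := by
      have : (0:ℝ) ≤ m := by positivity
      linarith
    have hG : (2*((n:ℝ)+1) + 2*((m:ℝ)+2) - 1) ≠ 0 := by
      have : (0:ℝ) ≤ m := by positivity
      have : (0:ℝ) ≤ n := by positivity
      linarith
    push_cast
    rw [show (2*((m:ℝ)+2) - 1) = 2*m+3 by ring,
      show (2*((n:ℝ)+1) + 2*((m:ℝ)+2) - 1) = 2*n+2*(m+2)+1 by ring]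
    field_simp
    ring
  · intro x h1 h2
    rw [jacobiP_eq _ _ _ _ h1 h2, div_pow (1 - x)]
    field_simp
    try ring
  · intro x h1 h2
    rw [intLegendreP_eq _ _ h1 h2, jacobiP_eq _ _ _ _ h1 h2]
    push_cast
    field_simp
    try ring
end

section
/- Define the type-III H(curl) shape functions on the triangle by v^III_{1j}(x,y) = ( (1−y)/4 , x/4 ) P̂_j^{3}(y) for integers j ≥ 1. Then for all integers j ≥ 1, k ≥ 2 and l ≥ 1: ∫_△ v^III_{1j}(x,y) · B_{kl}(x,y) dx dy = 0 and ∫_△ v^III_{1j}(x,y) · C_{kl}(x,y) dx dy = 0. -/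
open MeasureTheory

/-- Type-III `H(curl)` shape function `v^III_{1j}` on the triangle. -/
noncomputable def vTriIII (j : ℕ) (p : ℝ × ℝ) : ℝ × ℝ :=
  ((1 - p.2)/4 * intJacobiP j 3 p.2, p.1/4 * intJacobiP j 3 p.2)

open Polynomial in
/-- `D^i (X^2-1)^m`. -/
noncomputable def dU (i m : ℕ) : ℝ[X] := derivative^[i] ((X ^ 2 - 1) ^ m)

open Polynomial in
theorem dU_deriv (i m : ℕ) : derivative (dU i m) = dU (i+1) m := by
  simp only [dU, Function.iterate_succ', Function.comp]

open Polynomial in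
theorem iteratedDeriv_poly (p : ℝ[X]) (i : ℕ) :
    iteratedDeriv i (fun t : ℝ => p.eval t) = fun t => (derivative^[i] p).eval t := by
  induction i with
  | zero => simp
  | succ i ih =>
    rw [iteratedDeriv_succ, ih]
    funext t
    rw [Polynomial.deriv, Function.iterate_succ', Function.comp]

open Polynomial in
theorem dU_first (m : ℕ) : (X ^ 2 - 1) * dU 1 m = 2 * (m : ℝ[X]) * X * dU 0 m := by
  cases m with
  | zero => simp [dU]
  | succ m =>
    simp [dU, derivative_pow, show (C (2:ℝ)) = 2 from rfl]
    ring

open Polynomial in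
theorem dU_ode (m i : ℕ) : (X ^ 2 - 1) * dU (i+2) m =
    2 * ((m : ℝ[X]) - (i : ℝ[X]) - 1) * X * dU (i+1) m + ((i : ℝ[X]) + 1) * (2 * (m : ℝ[X]) - (i : ℝ[X])) * dU i m := by
  induction i with
  | zero =>
    have h := congrArg derivative (dU_first m)
    simp [derivative_mul, dU_deriv, derivative_pow] at h
    try simp only [show (C (2:ℝ)) = 2 from rfl] at h
    push_cast
    linear_combination h
  | succ i ih =>
    have h := congrArg derivative ih
    simp [derivative_mul, dU_deriv, derivative_pow] at h
    try simp only [show (C (2:ℝ)) = 2 from rfl] at h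
    push_cast
    linear_combination h

open Polynomial in
theorem dU_rec (m : ℕ) : dU (m+2) (m+1) =
    2 * ((m:ℝ[X]) + 1) * (X * dU (m+1) m + ((m:ℝ[X]) + 1) * dU m m) := by
  have h1 : dU 1 (m+1) = ((2 * (m + 1) : ℕ) : ℝ[X]) * ((X^2-1)^m * X) := by
    simp [dU, derivative_pow, show (C (2:ℝ)) = 2 from rfl]
    ring
  have h2 : dU (m+2) (m+1) = derivative^[m+1] (dU 1 (m+1)) := by
    simp only [dU, ← Function.iterate_add_apply]
  rw [h2, h1, iterate_derivative_natCast_mul, iterate_derivative_mul_X]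
  simp only [dU]
  push_cast
  simp only [nsmul_eq_mul, Nat.add_sub_cancel]
  push_cast
  ring

open Polynomial in
theorem leg_eq (n : ℕ) (x : ℝ) :
    legendreP n x = (1 / (2^n * (n.factorial : ℝ))) * (dU n n).eval x := by
  have : (fun t : ℝ => (1 - t)^0 * (1 + t)^0 * (t^2 - 1)^n)
      = fun t : ℝ => ((X^2 - 1 : ℝ[X])^n).eval t := by
    funext t; simp
  simp only [legendreP, jacobiP]
  rw [this, iteratedDeriv_poly]
  simp [dU]

open Polynomial in
theorem jac_eq (n : ℕ) (x : ℝ) (h1 : -1 < x) (h2 : x < 1) :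
    jacobiP n 1 1 x = (1 / (2^n * (n.factorial : ℝ) * (n+1) * (n+2))) * (dU (n+2) (n+1)).eval x := by
  have : (fun t : ℝ => (1 - t)^1 * (1 + t)^1 * (t^2 - 1)^n)
      = fun t : ℝ => (-(X^2 - 1 : ℝ[X])^(n+1)).eval t := by
    funext t; simp; ring
  simp only [jacobiP]
  rw [this, iteratedDeriv_poly]
  have h := congrArg (Polynomial.eval x) (dU_ode (n+1) n)
  simp at h
  have e : (derivative^[n] (-(X^2 - 1 : ℝ[X])^(n+1))).eval x = - (dU n (n+1)).eval x := by
    simp [dU, iterate_derivative_neg]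
  beta_reduce
  rw [e]
  have a1 : 1 - x ≠ 0 := by linarith
  have a2 : 1 + x ≠ 0 := by linarith
  have a3 : (n:ℝ) + 1 ≠ 0 := by positivity
  have a4 : (n:ℝ) + 2 ≠ 0 := by positivity
  have a5 : (n.factorial : ℝ) ≠ 0 := by positivity
  field_simp
  linear_combination h

theorem combo (n : ℕ) (x : ℝ) (h1 : -1 < x) (h2 : x < 1) :
    ((n:ℝ) + 3) * jacobiP (n+1) 1 1 x - (n + 2) * x * jacobiP n 1 1 x
      = 2 * (n + 2) * legendreP (n+1) x := by
  rw [jac_eq _ x h1 h2, jac_eq _ x h1 h2, leg_eq]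
  have h := congrArg (Polynomial.eval x) (dU_rec (n+1))
  simp at h
  rw [show n + 1 + 2 = n + 3 by ring, show n + 1 + 1 = n + 2 by ring] at *
  rw [h]
  have a3 : (n:ℝ) + 1 ≠ 0 := by positivity
  have a4 : (n:ℝ) + 2 ≠ 0 := by positivity
  have a6 : (n:ℝ) + 3 ≠ 0 := by positivity
  have a5 : (n.factorial : ℝ) ≠ 0 := by positivity
  have a7 : (n:ℝ) + 1 + 1 ≠ 0 := by positivity
  have a8 : (n:ℝ) + 1 + 2 ≠ 0 := by positivity
  rw [Nat.factorial_succ]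
  push_cast
  field_simp
  ring

open Polynomial in
theorem leg_int (n : ℕ) : ∫ x in (-1:ℝ)..1, legendreP (n+1) x = 0 := by
  simp only [leg_eq]
  rw [intervalIntegral.integral_const_mul]
  have hd : (X^2 - 1 : ℝ[X]) ∣ dU n (n+1) := by
    simpa [dU] using pow_sub_dvd_iterate_derivative_pow (X^2 - 1 : ℝ[X]) (n+1) n
  obtain ⟨q, hq⟩ := hd
  have : ∫ x in (-1:ℝ)..1, (dU (n+1) (n+1)).eval x = (dU n (n+1)).eval 1 - (dU n (n+1)).eval (-1) := by
    apply intervalIntegral.integral_eq_sub_of_hasDerivAt (f := fun x => (dU n (n+1)).eval x)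
    · intro x _
      rw [← dU_deriv]
      exact Polynomial.hasDerivAt _ x
    · exact (Polynomial.continuous _).intervalIntegrable _ _
  rw [this, hq]
  simp

theorem measTri : MeasurableSet Tri := by
  have : IsOpen Tri := by
    unfold Tri
    apply IsOpen.and
    · exact isOpen_lt continuous_const continuous_snd
    apply IsOpen.and
    · exact isOpen_lt continuous_snd continuous_const
    · exact isOpen_lt (by fun_prop) (by fun_prop)
  exact this.measurableSet

theorem tri_int_s13 (n : ℕ) (G : ℝ → ℝ) :
    ∫ p in Tri, G p.2 * legendreP (n+1) (2*p.1 / (1 - p.2)) = 0 := by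
  rw [← integral_indicator measTri]
  set F : ℝ × ℝ → ℝ := Tri.indicator (fun p => G p.2 * legendreP (n+1) (2*p.1 / (1 - p.2))) with hF
  by_cases hi : Integrable F
  swap
  · exact integral_undef hi
  have hi' : Integrable F ((volume : Measure ℝ).prod (volume : Measure ℝ)) := hi
  have := integral_prod_symm F hi'
  rw [Measure.volume_eq_prod, this]
  have key : ∀ y : ℝ, ∫ x, F (x, y) = 0 := by
    intro y
    by_cases hy : -1 < y ∧ y < 1
    · obtain ⟨hy1, hy2⟩ := hy
      set c := (1 - y)/2 with hc
      have hc0 : 0 < c := by rw [hc]; linarith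
      have : (fun x => F (x, y)) =
          (Set.Ioo (-c) c).indicator (fun x => G y * legendreP (n+1) (x / c)) := by
        funext x
        by_cases hx : x ∈ Set.Ioo (-c) c
        · rw [Set.indicator_of_mem hx, hF, Set.indicator_of_mem]
          · have : 2 * x / (1 - y) = x / c := by
              have : 1 - y ≠ 0 := by linarith
              rw [hc]; field_simp
            simp only [this]
          · exact ⟨hy1, hy2, abs_lt.2 hx⟩
        · rw [Set.indicator_of_notMem hx, hF, Set.indicator_of_notMem]
          exact fun h => hx (abs_lt.1 h.2.2)
      rw [this, integral_indicator measurableSet_Ioo, ← integral_Ioc_eq_integral_Ioo,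
        ← intervalIntegral.integral_of_le (by linarith), intervalIntegral.integral_const_mul,
        intervalIntegral.integral_comp_div _ hc0.ne', neg_div, div_self hc0.ne', leg_int]
      simp
    · have : (fun x => F (x, y)) = fun _ => 0 := by
        funext x
        rw [hF, Set.indicator_of_notMem]
        exact fun h => hy ⟨h.1, h.2.1⟩
      rw [this]; simp
  simp [key]

/-- The type-III shape functions on the triangle are orthogonal to both dual
candidates `B_{kl}` and `C_{kl}`. -/
theorem triangle_Hcurl_typeIII_orthogonal (j k l : ℕ) (hj : 1 ≤ j) (hk : 2 ≤ k)
    (hl : 1 ≤ l) :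
    (∫ p in Tri, dot2 (vTriIII j p) (Btri k l p) = 0) ∧
    (∫ p in Tri, dot2 (vTriIII j p) (Ctri k l p) = 0) := by
  obtain ⟨n, rfl⟩ : ∃ n, k = n + 2 := ⟨k - 2, by omega⟩
  constructor
  · rw [← tri_int_s13 n (fun y => (1 - y)/4 * intJacobiP j 3 y * ((1 - y)/2)^(n+1) *
      jacobiP (l-1) (2*(n+2)-1) 1 y)]
    apply setIntegral_congr_fun measTri
    intro p _
    simp only [dot2, vTriIII, Btri, show n + 2 - 1 = n + 1 by omega]
    ring
  · rw [← tri_int_s13 n (fun y => (1 - y)/4 * intJacobiP j 3 y * ((1 - y)/2)^(n+1) *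
      jacobiP (l-1) (2*(n+2)) 0 y * (2 * (n + 2)))]
    apply setIntegral_congr_fun measTri
    rintro ⟨x, y⟩ ⟨h1, h2, h3⟩
    simp only at h1 h2 h3
    have hy : 0 < 1 - y := by linarith
    obtain ⟨h4, h5⟩ := abs_lt.1 h3
    have b1 : -1 < 2 * x / (1 - y) := by rw [lt_div_iff₀ hy]; linarith
    have b2 : 2 * x / (1 - y) < 1 := by rw [div_lt_iff₀ hy]; linarith
    have hc := combo n _ b1 b2
    simp only [dot2, vTriIII, Ctri, show n + 2 - 1 = n + 1 by omega, show n + 2 - 2 = n by omega]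
    have hx : x = (2 * x / (1 - y)) * (1 - y) / 2 := by field_simp
    generalize 2 * x / (1 - y) = e at *
    subst hx
    push_cast
    linear_combination ((1 - y)/4 * intJacobiP j 3 y * ((1 - y)/2)^(n+1) *
      jacobiP (l-1) (2*(n+2)) 0 y) * hc
end

section
/- For all integers i ≥ 2 and k ≥ 2: (k+1) ∫_{−1}^{1} L_{i−1}(x) P^{(1,1)}_{k−1}(x) dx = k ∫_{−1}^{1} L_{i−2}(x) P^{(1,1)}_{k−2}(x) dx. (This is the cancellation identity used to construct the second dual family C_{kl} on the triangle.) -/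
open MeasureTheory

open Polynomial in
lemma ljc_ode (m r : ℕ) :
    ((X:ℝ[X])^2 - 1) * derivative^[r+2] (((X:ℝ[X])^2-1)^m)
      + 2 * ((r:ℝ[X])+1) * X * derivative^[r+1] (((X:ℝ[X])^2-1)^m)
      + ((r:ℝ[X])+1) * (r:ℝ[X]) * derivative^[r] (((X:ℝ[X])^2-1)^m)
    = 2 * (m:ℝ[X]) * (X * derivative^[r+1] (((X:ℝ[X])^2-1)^m)
        + ((r:ℝ[X])+1) * derivative^[r] (((X:ℝ[X])^2-1)^m)) := by
  induction r with
  | zero =>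
    have h : ((X:ℝ[X])^2 - 1) * derivative (((X:ℝ[X])^2-1)^m)
        = 2 * (m:ℝ[X]) * X * ((X:ℝ[X])^2-1)^m := by
      rcases m with _ | m
      · simp
      · rw [derivative_pow]
        simp
        ring
    have h2 := congrArg derivative h
    simp only [derivative_mul, derivative_sub, derivative_X_pow, derivative_one, derivative_X,
      derivative_natCast, derivative_ofNat] at h2
    simp only [Function.iterate_succ_apply', Function.iterate_zero, id]
    simp [show (C (2:ℝ)) = 2 from rfl] at h2 ⊢
    linear_combination h2
  | succ r ih =>
    have h2 := congrArg derivative ih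
    simp only [derivative_mul, derivative_sub, derivative_add, derivative_X_pow, derivative_one,
      derivative_X, derivative_natCast, derivative_ofNat, ← Function.iterate_succ_apply' derivative] at h2
    simp [-Function.iterate_succ, show (C (2:ℝ)) = 2 from rfl] at h2
    push_cast
    simp only [Function.iterate_succ_apply'] at h2 ⊢
    linear_combination h2

open Polynomial in
lemma ljc_iter (p : ℝ[X]) (n : ℕ) (x : ℝ) :
    iteratedDeriv n (fun t => p.eval t) x = (derivative^[n] p).eval x := by
  induction n generalizing p with
  | zero => simp
  | succ n ih =>
    rw [iteratedDeriv_succ', Function.iterate_succ_apply, ← ih]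
    congr 1
    funext t
    simp

open Polynomial in
lemma ljc_leg (n : ℕ) (x : ℝ) : legendreP n x =
    (1 / ((2:ℝ)^n * (n.factorial:ℝ))) * (derivative^[n] (((X:ℝ[X])^2-1)^n)).eval x := by
  rw [← ljc_iter]
  simp [legendreP, jacobiP]

open Polynomial in
lemma ljc_jac (n : ℕ) (x : ℝ) (h : x^2 ≠ 1) : jacobiP n 1 1 x =
    (1 / ((2:ℝ)^n * (n.factorial:ℝ) * ((n+1) * (n+2))))
      * (derivative (derivative^[n+1] (((X:ℝ[X])^2-1)^(n+1)))).eval x := by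
  have e : (fun t : ℝ => (1 - t)^1 * (1 + t)^1 * (t^2 - 1)^n)
      = fun t => (-(((X:ℝ[X])^2-1)^(n+1))).eval t := by
    funext t; simp; ring
  have o := congrArg (eval x) (ljc_ode (n+1) n)
  rw [jacobiP, e, ljc_iter, ← Function.iterate_succ_apply' derivative]
  simp only [eval_add, eval_mul, eval_sub, eval_pow, eval_X, eval_one, eval_natCast, eval_ofNat,
    Nat.cast_add, Nat.cast_one] at o
  rw [iterate_derivative_neg, eval_neg]
  have h1 : (1 - x) ≠ 0 := fun h' => h (by rw [show x = 1 by linarith]; norm_num)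
  have h2 : (1 + x) ≠ 0 := fun h' => h (by rw [show x = -1 by linarith]; norm_num)
  have h3 : (n:ℝ) + 1 ≠ 0 := by positivity
  have h4 : (n:ℝ) + 2 ≠ 0 := by positivity
  have h5 : (n.factorial:ℝ) ≠ 0 := by positivity
  field_simp
  linear_combination o

open Polynomial in
lemma ljc_parts (p q : ℝ[X]) :
    ∫ x in (-1:ℝ)..1, p.eval x * (derivative q).eval x =
      p.eval 1 * q.eval 1 - p.eval (-1) * q.eval (-1)
      - ∫ x in (-1:ℝ)..1, (derivative p).eval x * q.eval x :=
  intervalIntegral.integral_mul_deriv_eq_deriv_mul (fun x _ => p.hasDerivAt x)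
    (fun x _ => q.hasDerivAt x) ((derivative p).continuous.intervalIntegrable _ _)
    ((derivative q).continuous.intervalIntegrable _ _)

open Polynomial in
lemma ljc_fac1 (m : ℕ) : ((X:ℝ[X])^2-1)^m = (X - C (1:ℝ))^m * (X+1)^m := by
  rw [← mul_pow]; congr 1; simp; ring

open Polynomial in
lemma ljc_fac2 (m : ℕ) : ((X:ℝ[X])^2-1)^m = (X - C (-1:ℝ))^m * (X-1)^m := by
  rw [← mul_pow]; congr 1; simp; ring

open Polynomial in
lemma ljc_orth (m r : ℕ) (hr : r ≤ m) (q : ℝ[X]) (hq : derivative^[r] q = 0) :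
    ∫ x in (-1:ℝ)..1, q.eval x * (derivative^[r] (((X:ℝ[X])^2-1)^m)).eval x = 0 := by
  induction r generalizing q with
  | zero => simp at hq; simp [hq]
  | succ r ih =>
    rw [Function.iterate_succ_apply', ljc_parts, ih (by omega) _ (by simpa using hq)]
    have a1 := aeval_iterate_derivative_of_lt (A := ℝ) (((X:ℝ[X])^2-1)^m) m (1:ℝ)
      (p' := (X+1)^m) (by simpa using ljc_fac1 m) (k := r) (by omega)
    have a2 := aeval_iterate_derivative_of_lt (A := ℝ) (((X:ℝ[X])^2-1)^m) m (-1:ℝ)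
      (p' := (X-1)^m) (by simpa using ljc_fac2 m) (k := r) (by omega)
    simp only [coe_aeval_eq_eval] at a1 a2
    rw [a1, a2]; simp

open Polynomial in
noncomputable def ljcL (m : ℕ) : ℝ[X] :=
  C (1 / ((2:ℝ)^m * (m.factorial:ℝ))) * (derivative^[m] (((X:ℝ[X])^2-1)^m))

open Polynomial in
lemma ljc_one (m : ℕ) : (ljcL m).eval 1 = 1 := by
  have a1 := aeval_iterate_derivative_self (A := ℝ) (((X:ℝ[X])^2-1)^m) m (1:ℝ)
      (p' := (X+1)^m) (by simpa using ljc_fac1 m)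
  simp only [coe_aeval_eq_eval] at a1
  have h5 : (m.factorial:ℝ) ≠ 0 := by positivity
  rw [ljcL, eval_mul, a1]
  simp
  norm_num
  field_simp

open Polynomial in
lemma ljc_neg_one (m : ℕ) : (ljcL m).eval (-1) = (-1)^m := by
  have a1 := aeval_iterate_derivative_self (A := ℝ) (((X:ℝ[X])^2-1)^m) m (-1:ℝ)
      (p' := (X-1)^m) (by simpa using ljc_fac2 m)
  simp only [coe_aeval_eq_eval] at a1
  have h5 : (m.factorial:ℝ) ≠ 0 := by positivity
  rw [ljcL, eval_mul, a1]
  have h6 : (-2:ℝ)^m = (-1)^m * 2^m := by rw [← mul_pow]; norm_num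
  simp
  norm_num
  rw [h6]
  field_simp

open Polynomial in
lemma ljc_deg (m : ℕ) : (ljcL m).natDegree ≤ m := by
  refine (natDegree_C_mul_le _ _).trans ((natDegree_iterate_derivative _ _).trans ?_)
  have : (((X:ℝ[X])^2-1)^m).natDegree ≤ m * 2 :=
    natDegree_pow_le_of_le m (by compute_degree)
  omega

open Polynomial in
lemma ljc_orth' (m : ℕ) (q : ℝ[X]) (hq : derivative^[m] q = 0) :
    ∫ x in (-1:ℝ)..1, q.eval x * (ljcL m).eval x = 0 := by
  have := ljc_orth m m le_rfl q hq
  simp only [ljcL, eval_mul, eval_C, mul_left_comm (eval _ q), intervalIntegral.integral_const_mul,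
    this, mul_zero]

open Polynomial in
lemma ljc_val (j k : ℕ) : ∫ x in (-1:ℝ)..1, (ljcL j).eval x * (derivative (ljcL (k+1))).eval x
    = if j ≤ k then 1 + (-1)^(j+k) else 0 := by
  split_ifs with h
  · rw [ljc_parts, ljc_orth', ljc_one, ljc_one, ljc_neg_one, ljc_neg_one]
    · ring
    · rw [← Function.iterate_succ_apply]
      exact iterate_derivative_eq_zero (by have := ljc_deg j; omega)
  · simp only [mul_comm (eval _ (ljcL j))]
    apply ljc_orth'
    apply iterate_derivative_eq_zero
    have h1 := ljc_deg (k+1)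
    have h2 := natDegree_derivative_le (ljcL (k+1))
    omega

open Polynomial in
lemma ljc_main (j n : ℕ) : ((n:ℝ)+2) * ∫ x in (-1:ℝ)..1, legendreP j x * jacobiP n 1 1 x
    = 2 * if j ≤ n then 1 + (-1)^(j+n) else 0 := by
  rw [← ljc_val, ← intervalIntegral.integral_const_mul, ← intervalIntegral.integral_const_mul]
  apply intervalIntegral.integral_congr_ae
  have h1 : ∀ᵐ x : ℝ, x ≠ 1 := by simp [ae_iff]
  have h2 : ∀ᵐ x : ℝ, x ≠ -1 := by simp [ae_iff]
  filter_upwards [h1, h2] with x h1 h2 _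
  have hx : x^2 ≠ 1 := by
    intro h
    rcases (sq_eq_sq_iff_eq_or_eq_neg.mp (h.trans (one_pow 2).symm)) with h | h
    · exact h1 h
    · exact h2 h
  rw [ljc_leg, ljc_jac n x hx, ljcL, ljcL, derivative_C_mul, eval_mul, eval_mul, eval_C, eval_C,
    Nat.factorial_succ]
  have h5 : (n.factorial:ℝ) ≠ 0 := by positivity
  push_cast
  field_simp
  ring

/-- The cancellation identity used to construct the second dual family on the
triangle. -/
theorem legendre_jacobi_cancellation (i k : ℕ) (hi : 2 ≤ i) (hk : 2 ≤ k) :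
    ((k:ℝ) + 1) * ∫ x in (-1:ℝ)..1, legendreP (i-1) x * jacobiP (k-1) 1 1 x =
      (k:ℝ) * ∫ x in (-1:ℝ)..1, legendreP (i-2) x * jacobiP (k-2) 1 1 x := by
  obtain ⟨i, rfl⟩ := Nat.exists_eq_add_of_le' hi
  obtain ⟨k, rfl⟩ := Nat.exists_eq_add_of_le' hk
  have a := ljc_main (i+1) (k+1)
  have b := ljc_main i k
  simp only [Nat.add_sub_cancel, show i + 2 - 1 = i + 1 by omega, show k + 2 - 1 = k + 1 by omega]
  push_cast at a ⊢
  rw [b, show ((k:ℝ) + 2 + 1) = k + 1 + 2 by ring, a]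
  have e : (-1:ℝ)^(i + 1 + (k + 1)) = (-1)^(i+k) := by ring
  rw [e]
end
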